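/- arXiv:2501.15419 — 3 statements merged into one kernel-verified Lean document; each statement's English description precedes it below -/
import Mathlib

section
/- Let ρ₁, ρ₂, ρ₃ be forcing functions and μ_k > 0 with μ_k → 0, and let x_k ∈ E, z_k ∈ ℝ^m satisfy for every k: ‖∇_x L(x_k,z_k)‖ ≤ ρ₁(μ_k), (Σ_{i=1}^m ((z_k)_i g_i(x_k) − μ_k)²)^{1/2} ≤ ρ₂(μ_k), λ_min[H(x_k,z_k)] ≥ −ρ₃(μ_k), g_i(x_k) > 0 and (z_k)_i > 0 for all i. Let k_0 < k_1 < ⋯ be a subsequence that is asymptotically consistent, i.e. for each i ∈ {1,…,m} either lim_{n→∞} g_i(x_{k_n}) = 0 or liminf_{n→∞} g_i(x_{k_n}) > 0; let W = {i : lim_{n→∞} g_i(x_{k_n}) = 0}, and assume for every i that the sequence (‖∇g_i(x_{k_n})‖)_n is bounded. Let v_n ∈ E be any sequence with sup_n ‖v_n‖ < ∞ and ⟨∇g_i(x_{k_n}), v_n⟩ = 0 for all i ∈ W and all n. Then liminf_{n→∞} ⟨Hess_x L(x_{k_n}, z_{k_n}) v_n, v_n⟩ ≥ 0. -/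
open Filter Topology
open scoped RealInnerProductSpace BigOperators

noncomputable section

variable {E : Type*} [NormedAddCommGroup E] [InnerProductSpace ℝ E] [FiniteDimensional ℝ E]

/-- A forcing function: continuous on `[0,∞)`, nonnegative there, vanishing exactly at `0`. -/
def IsForcing (ρ : ℝ → ℝ) : Prop :=
  ContinuousOn ρ (Set.Ici 0) ∧ (∀ t, 0 ≤ t → 0 ≤ ρ t) ∧ ∀ t, 0 ≤ t → (ρ t = 0 ↔ t = 0)

/-- The Hessian of `h` at `x`, i.e. the derivative of the gradient field of `h` at `x`. -/
def Hess (h : E → ℝ) (x : E) : E →L[ℝ] E := fderiv ℝ (gradient h) x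

/-- Gradient of the Lagrangian `L(x,z) = f(x) - ∑ i, z i * g i x` with respect to `x`. -/
def gradL {m : ℕ} (f : E → ℝ) (g : Fin m → E → ℝ) (x : E) (z : Fin m → ℝ) : E :=
  gradient f x - ∑ i, z i • gradient (g i) x

/-- Hessian of the Lagrangian with respect to `x`. -/
def hessL {m : ℕ} (f : E → ℝ) (g : Fin m → E → ℝ) (x : E) (z : Fin m → ℝ) : E →L[ℝ] E :=
  Hess f x - ∑ i, z i • Hess (g i) x

/-- The condensed primal-dual operator `H(x,z)`,
`H(x,z) v = Hess_x L(x,z) v + ∑ i (z i / g i x) ⟪∇g i x, v⟫ ∇g i x`. -/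
def Hxz {m : ℕ} (f : E → ℝ) (g : Fin m → E → ℝ) (x : E) (z : Fin m → ℝ) : E →L[ℝ] E :=
  hessL f g x z +
    ∑ i, (z i / g i x) • ((innerSL ℝ (gradient (g i) x)).smulRight (gradient (g i) x))

/-- Smallest Rayleigh-quotient value of `A` over the unit sphere. -/
def lamMin (A : E →L[ℝ] E) : ℝ := sInf ((fun v => ⟪A v, v⟫) '' {v : E | ‖v‖ = 1})

/-- The log-barrier merit function `φ_μ`. -/
def barrierPhi {m : ℕ} (μ : ℝ) (f : E → ℝ) (g : Fin m → E → ℝ) (x : E) : ℝ :=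
  f x - μ * ∑ i, Real.log (g i x)

/-- The barrier gradient `q_μ(x) = ∇f(x) - μ ∑ i ∇g i (x) / g i x`. -/
def qmu {m : ℕ} (μ : ℝ) (f : E → ℝ) (g : Fin m → E → ℝ) (x : E) : E :=
  gradient f x - μ • ∑ i, (g i x)⁻¹ • gradient (g i) x

/-- Trust-region model `m_{x,z,μ}(d)`. -/
def trModel {m : ℕ} (μ : ℝ) (f : E → ℝ) (g : Fin m → E → ℝ) (x : E) (z : Fin m → ℝ)
    (d : E) : ℝ :=
  (1/2) * ⟪Hxz f g x z d, d⟫ + ⟪qmu μ f g x, d⟫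

/-- Predicted reduction of the step `d`. -/
def predRed {m : ℕ} (μ : ℝ) (f : E → ℝ) (g : Fin m → E → ℝ) (x : E) (z : Fin m → ℝ)
    (d : E) : ℝ :=
  - trModel μ f g x z d

/-- Actual reduction of the step `d`. -/
def aredRed {m : ℕ} (μ : ℝ) (f : E → ℝ) (g : Fin m → E → ℝ) (x : E) (d : E) : ℝ :=
  barrierPhi μ f g x - barrierPhi μ f g (x + d)


theorem exists_pos_eventually_le_of_liminf_pos {u : ℕ → ℝ} (h : 0 < liminf u atTop) :
    ∃ a, 0 < a ∧ ∀ᶠ n in atTop, a ≤ u n := by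
  by_contra! H
  rw [liminf_eq] at h
  refine h.not_ge (Real.sSup_nonpos fun a ha => ?_)
  by_contra! hpos
  exact H a hpos (ha.mono fun _ => not_lt.mpr)

theorem liminf_nonneg_of_tendsto_zero_le {u b : ℕ → ℝ} (hb : Tendsto b atTop (𝓝 0))
    (hbu : ∀ n, b n ≤ u n) : 0 ≤ liminf u atTop := by
  rw [liminf_eq]
  by_cases hS : BddAbove {a | ∀ᶠ n in atTop, a ≤ u n}
  · refine le_of_forall_lt fun c hc => ?_
    obtain ⟨d, hcd, hd⟩ := exists_between hc
    refine hcd.trans_le (le_csSup hS ?_)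
    filter_upwards [hb.eventually (lt_mem_nhds hd)] with n hn
    exact hn.le.trans (hbu n)
  · rw [Real.sSup_of_not_bddAbove hS]

theorem lamMin_mul_norm_sq_le_inner {E : Type*} [NormedAddCommGroup E] [InnerProductSpace ℝ E]
    (A : E →L[ℝ] E) (v : E) : lamMin A * ‖v‖ ^ 2 ≤ ⟪A v, v⟫ := by
  rcases eq_or_ne v 0 with rfl | hv
  · simp
  have hn : 0 < ‖v‖ := norm_pos_iff.mpr hv
  have hbdd : BddBelow ((fun v => ⟪A v, v⟫) '' {v : E | ‖v‖ = 1}) := by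
    refine ⟨-‖A‖, ?_⟩
    rintro _ ⟨w, hw, rfl⟩
    have hw : ‖w‖ = 1 := hw
    have hA : ‖A w‖ ≤ ‖A‖ := by simpa [hw] using A.le_opNorm w
    have hin := (abs_le.mp (abs_real_inner_le_norm (A w) w)).1
    rw [hw, mul_one] at hin
    show -‖A‖ ≤ ⟪A w, w⟫
    linarith
  have hle : lamMin A ≤ ⟪A (‖v‖⁻¹ • v), ‖v‖⁻¹ • v⟫ :=
    csInf_le hbdd ⟨‖v‖⁻¹ • v, by simp [norm_smul, hn.ne'], rfl⟩
  rw [map_smul, real_inner_smul_left, real_inner_smul_right] at hle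
  calc lamMin A * ‖v‖ ^ 2 ≤ ‖v‖⁻¹ * (‖v‖⁻¹ * ⟪A v, v⟫) * ‖v‖ ^ 2 := by gcongr
    _ = ⟪A v, v⟫ := by field_simp

theorem inner_Hxz_self {E : Type*} [NormedAddCommGroup E] [InnerProductSpace ℝ E]
    [FiniteDimensional ℝ E] {m : ℕ} (f : E → ℝ) (g : Fin m → E → ℝ) (x : E) (z : Fin m → ℝ)
    (v : E) :
    ⟪Hxz f g x z v, v⟫ =
      ⟪hessL f g x z v, v⟫ + ∑ i, z i / g i x * ⟪gradient (g i) x, v⟫ ^ 2 := by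
  simp only [Hxz, add_apply, sum_apply,
    smul_apply, ContinuousLinearMap.smulRight_apply, innerSL_apply_apply,
    inner_add_left, sum_inner, real_inner_smul_left]
  congr 1
  exact Finset.sum_congr rfl fun i _ => by ring

theorem IsForcing.tendsto_zero {ρ : ℝ → ℝ} (hρ : IsForcing ρ) {μ : ℕ → ℝ} (hμpos : ∀ k, 0 < μ k)
    (hμ0 : Tendsto μ atTop (𝓝 0)) : Tendsto (fun k => ρ (μ k)) atTop (𝓝 0) := by
  have h := hρ.1 0 Set.self_mem_Ici
  rw [ContinuousWithinAt, (hρ.2.2 0 le_rfl).mpr rfl] at h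
  exact h.comp (tendsto_nhdsWithin_iff.mpr ⟨hμ0, .of_forall fun k => (hμpos k).le⟩)

/-- Second-order limit inferior along an asymptotically consistent
subsequence of the outer iterates. -/
theorem outer_second_order_liminf
    {E : Type*} [NormedAddCommGroup E] [InnerProductSpace ℝ E] [FiniteDimensional ℝ E]
    [Nontrivial E] {m : ℕ} (hm : 1 ≤ m)
    (f : E → ℝ) (g : Fin m → E → ℝ)
    (hf : ContDiff ℝ 2 f) (hg : ∀ i, ContDiff ℝ 2 (g i))
    (ρ₁ ρ₂ ρ₃ : ℝ → ℝ) (hρ₁ : IsForcing ρ₁) (hρ₂ : IsForcing ρ₂) (hρ₃ : IsForcing ρ₃)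
    (μ : ℕ → ℝ) (hμpos : ∀ k, 0 < μ k) (hμ0 : Tendsto μ atTop (𝓝 0))
    (x : ℕ → E) (z : ℕ → Fin m → ℝ)
    (h1 : ∀ k, ‖gradL f g (x k) (z k)‖ ≤ ρ₁ (μ k))
    (h2 : ∀ k, Real.sqrt (∑ i, (z k i * g i (x k) - μ k) ^ 2) ≤ ρ₂ (μ k))
    (h3 : ∀ k, -ρ₃ (μ k) ≤ lamMin (Hxz f g (x k) (z k)))
    (h4 : ∀ k i, 0 < g i (x k) ∧ 0 < z k i)
    -- the asymptotically consistent subsequence `k₀ < k₁ < ⋯`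
    (k : ℕ → ℕ) (hk : StrictMono k)
    (hac : ∀ i, Tendsto (fun n => g i (x (k n))) atTop (𝓝 0) ∨
      0 < liminf (fun n => g i (x (k n))) atTop)
    (hgradbd : ∀ i, ∃ C : ℝ, ∀ n, ‖gradient (g i) (x (k n))‖ ≤ C)
    -- the sequence of tangent vectors
    (v : ℕ → E) (hvbd : ∃ C : ℝ, ∀ n, ‖v n‖ ≤ C)
    (hvW : ∀ i, Tendsto (fun n => g i (x (k n))) atTop (𝓝 0) →
      ∀ n, ⟪gradient (g i) (x (k n)), v n⟫ = 0) :
    0 ≤ liminf (fun n => ⟪hessL f g (x (k n)) (z (k n)) (v n), v n⟫) atTop := by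
  obtain ⟨C, hC⟩ := hvbd
  have hk0 := hk.tendsto_atTop
  have hμk : Tendsto (fun n => μ (k n)) atTop (𝓝 0) := hμ0.comp hk0
  have hρ₂k : Tendsto (fun n => ρ₂ (μ (k n))) atTop (𝓝 0) :=
    (hρ₂.tendsto_zero hμpos hμ0).comp hk0
  have hρ₃k : Tendsto (fun n => ρ₃ (μ (k n))) atTop (𝓝 0) :=
    (hρ₃.tendsto_zero hμpos hμ0).comp hk0
  have hterm (i : Fin m) : Tendsto (fun n => z (k n) i / g i (x (k n)) *
      ⟪gradient (g i) (x (k n)), v n⟫ ^ 2) atTop (𝓝 0) := by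
    rcases hac i with hi | hi
    · simp [hvW i hi]
    obtain ⟨a, ha, hag⟩ := exists_pos_eventually_le_of_liminf_pos hi
    obtain ⟨B, hB⟩ := hgradbd i
    have hbound : Tendsto (fun n => (μ (k n) + ρ₂ (μ (k n))) / a ^ 2 * (B * C) ^ 2)
        atTop (𝓝 0) := by
      simpa using ((hμk.add hρ₂k).div_const (a ^ 2)).mul_const ((B * C) ^ 2)
    refine squeeze_zero' (.of_forall fun n => ?_) ?_ hbound
    · have := h4 (k n) i
      have := this.1.le
      have := (h4 (k n) i).2.le
      positivity
    filter_upwards [hag] with n hn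
    obtain ⟨hgpos, hzpos⟩ := h4 (k n) i
    have hcomp : z (k n) i * g i (x (k n)) ≤ μ (k n) + ρ₂ (μ (k n)) := by
      have hsq : (z (k n) i * g i (x (k n)) - μ (k n)) ^ 2 ≤
          ∑ j, (z (k n) j * g j (x (k n)) - μ (k n)) ^ 2 :=
        Finset.single_le_sum (f := fun j => (z (k n) j * g j (x (k n)) - μ (k n)) ^ 2)
          (fun j _ => sq_nonneg _) (Finset.mem_univ i)
      linarith [Real.le_sqrt_of_sq_le hsq, h2 (k n)]
    have hratio : z (k n) i / g i (x (k n)) ≤ (μ (k n) + ρ₂ (μ (k n))) / a ^ 2 :=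
      calc z (k n) i / g i (x (k n)) = z (k n) i * g i (x (k n)) / g i (x (k n)) ^ 2 := by
            field_simp
        _ ≤ (μ (k n) + ρ₂ (μ (k n))) / a ^ 2 := by
            gcongr
            exact (mul_pos hzpos hgpos).le.trans hcomp
    have hinner : ⟪gradient (g i) (x (k n)), v n⟫ ^ 2 ≤ (B * C) ^ 2 :=
      sq_le_sq.mpr <| (abs_real_inner_le_norm _ _).trans <|
        (mul_le_mul (hB n) (hC n) (norm_nonneg _) ((norm_nonneg _).trans (hB n))).trans
          (le_abs_self _)
    exact mul_le_mul hratio hinner (sq_nonneg _) ((div_pos hzpos hgpos).le.trans hratio)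
  have hlower : Tendsto (fun n => -ρ₃ (μ (k n)) * C ^ 2 - ∑ i, z (k n) i / g i (x (k n)) *
      ⟪gradient (g i) (x (k n)), v n⟫ ^ 2) atTop (𝓝 0) := by
    simpa using (hρ₃k.neg.mul_const (C ^ 2)).sub (tendsto_finsetSum _ fun i _ => hterm i)
  refine liminf_nonneg_of_tendsto_zero_le hlower fun n => ?_
  have hray := lamMin_mul_norm_sq_le_inner (Hxz f g (x (k n)) (z (k n))) (v n)
  rw [inner_Hxz_self] at hray
  have hlam := mul_le_mul_of_nonneg_right (h3 (k n)) (sq_nonneg ‖v n‖)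
  have hv : ρ₃ (μ (k n)) * ‖v n‖ ^ 2 ≤ ρ₃ (μ (k n)) * C ^ 2 :=
    mul_le_mul_of_nonneg_left (pow_le_pow_left₀ (norm_nonneg _) (hC n) 2)
      (hρ₃.2.1 _ (hμpos _).le)
  linarith

end
end

section
/- Let ρ₁ and ρ₂ be forcing functions, μ_k > 0 with μ_k → 0, and let x_k ∈ E, z_k ∈ ℝ^m satisfy for every k: ‖∇_x L(x_k,z_k)‖ ≤ ρ₁(μ_k), (Σ_{i=1}^m ((z_k)_i g_i(x_k) − μ_k)²)^{1/2} ≤ ρ₂(μ_k), g_i(x_k) > 0 and (z_k)_i > 0 for all i. If x_k → x* ∈ E, then x* is feasible, i.e. g_i(x*) ≥ 0 for all i, and x* is an approximate-KKT (AKKT) point, witnessed by the given sequences: x_k → x*, lim_{k→∞} ∇_x L(x_k, z_k) = 0, and lim_{k→∞} Σ_{i=1}^m max{(z_k)_i g_i(x_k), 0} = 0. -/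
open Filter Topology
open scoped RealInnerProductSpace BigOperators

noncomputable section

variable {E : Type*} [NormedAddCommGroup E] [InnerProductSpace ℝ E] [FiniteDimensional ℝ E]

theorem IsForcing.tendsto_comp {ρ : ℝ → ℝ} (hρ : IsForcing ρ) {α : Type*} {l : Filter α}
    {μ : α → ℝ} (hμ : ∀ k, 0 ≤ μ k) (hμ0 : Tendsto μ l (𝓝 0)) :
    Tendsto (fun k => ρ (μ k)) l (𝓝 0) := by
  have h : Tendsto ρ (𝓝[Set.Ici 0] 0) (𝓝 0) := by
    simpa [(hρ.2.2 0 le_rfl).2 rfl] using (hρ.1 0 Set.self_mem_Ici).tendsto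
  exact h.comp (tendsto_nhdsWithin_iff.2 ⟨hμ0, Eventually.of_forall hμ⟩)

/-- Any limit of the outer iterates is a feasible AKKT point,
witnessed by the given sequences. -/
theorem outer_limit_is_AKKT
    {E : Type*} [NormedAddCommGroup E] [InnerProductSpace ℝ E] [FiniteDimensional ℝ E]
    [Nontrivial E] {m : ℕ} (hm : 1 ≤ m)
    (f : E → ℝ) (g : Fin m → E → ℝ)
    (hf : ContDiff ℝ 2 f) (hg : ∀ i, ContDiff ℝ 2 (g i))
    (ρ₁ ρ₂ : ℝ → ℝ) (hρ₁ : IsForcing ρ₁) (hρ₂ : IsForcing ρ₂)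
    (μ : ℕ → ℝ) (hμpos : ∀ k, 0 < μ k) (hμ0 : Tendsto μ atTop (𝓝 0))
    (x : ℕ → E) (z : ℕ → Fin m → ℝ)
    (h1 : ∀ k, ‖gradL f g (x k) (z k)‖ ≤ ρ₁ (μ k))
    (h2 : ∀ k, Real.sqrt (∑ i, (z k i * g i (x k) - μ k) ^ 2) ≤ ρ₂ (μ k))
    (h3 : ∀ k i, 0 < g i (x k) ∧ 0 < z k i)
    (xs : E) (hx : Tendsto x atTop (𝓝 xs)) :
    (∀ i, 0 ≤ g i xs) ∧
    Tendsto x atTop (𝓝 xs) ∧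
    Tendsto (fun k => gradL f g (x k) (z k)) atTop (𝓝 0) ∧
    Tendsto (fun k => ∑ i, max (z k i * g i (x k)) 0) atTop (𝓝 0) := by
  have hμ : ∀ k, 0 ≤ μ k := fun k => (hμpos k).le
  refine ⟨fun i => ?_, hx, squeeze_zero_norm h1 (hρ₁.tendsto_comp hμ hμ0), ?_⟩
  · exact ge_of_tendsto' (((hg i).continuous.tendsto xs).comp hx) fun k => (h3 k i).1.le
  · have key : ∀ i, Tendsto (fun k => z k i * g i (x k)) atTop (𝓝 0) := fun i => by
      have hd : Tendsto (fun k => z k i * g i (x k) - μ k) atTop (𝓝 0) :=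
        squeeze_zero_norm (fun k => (Real.abs_le_sqrt (Finset.single_le_sum
          (f := fun j => (z k j * g j (x k) - μ k) ^ 2)
          (fun j _ => sq_nonneg _) (Finset.mem_univ i))).trans (h2 k))
          (hρ₂.tendsto_comp hμ hμ0)
      simpa using hd.add hμ0
    simpa using tendsto_finsetSum Finset.univ
      fun i _ => (key i).max (tendsto_const_nhds (x := (0 : ℝ)))

end
end

section
/- Under the inner-iteration setting, liminf_{ℓ→∞} ‖q_μ(x^ℓ)‖ = 0. -/
open Filter Topology
open scoped RealInnerProductSpace BigOperators

noncomputable section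

variable {E : Type*} [NormedAddCommGroup E] [InnerProductSpace ℝ E] [FiniteDimensional ℝ E]

/-- The inner-iteration setting of the interior-point trust-region method (with the
log-barrier merit function), including all standing assumptions. -/
structure InnerSetting (m : ℕ) (f : E → ℝ) (g : Fin m → E → ℝ)
    (μ τ κC ω Δmax : ℝ)
    (x : ℕ → E) (z : ℕ → Fin m → ℝ) (d : ℕ → E) (Δ : ℕ → ℝ) : Prop where
  hm : 1 ≤ m
  hf : ContDiff ℝ 2 f
  hg : ∀ i, ContDiff ℝ 2 (g i)
  hμ : 0 < μ
  hτ : 0 < τ ∧ τ < 1/4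
  hκC : 0 < κC
  hω : 0 < ω ∧ ω < 1
  hΔmax : 0 < Δmax
  hΔ : ∀ ℓ, 0 < Δ ℓ ∧ Δ ℓ ≤ Δmax
  /-- (i) strict feasibility of the iterates -/
  hgpos : ∀ ℓ i, 0 < g i (x ℓ)
  hzpos : ∀ ℓ i, 0 < z ℓ i
  /-- (ii) the step is inside the trust region -/
  hdΔ : ∀ ℓ, ‖d ℓ‖ ≤ Δ ℓ
  /-- (iii) Cauchy decrease, case `H^ℓ = 0` -/
  cauchy_zero : ∀ ℓ, Hxz f g (x ℓ) (z ℓ) = 0 →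
    κC * ‖qmu μ f g (x ℓ)‖ * Δ ℓ ≤ predRed μ f g (x ℓ) (z ℓ) (d ℓ)
  /-- (iii) Cauchy decrease, case `H^ℓ ≠ 0` -/
  cauchy : ∀ ℓ, Hxz f g (x ℓ) (z ℓ) ≠ 0 →
    κC * ‖qmu μ f g (x ℓ)‖ *
        min (Δ ℓ) (‖qmu μ f g (x ℓ)‖ / ‖Hxz f g (x ℓ) (z ℓ)‖) ≤
      predRed μ f g (x ℓ) (z ℓ) (d ℓ)
  /-- (iv) update on a successful iteration -/
  succ_update : ∀ ℓ, ((∀ i, 0 < g i (x ℓ + d ℓ)) ∧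
      τ * predRed μ f g (x ℓ) (z ℓ) (d ℓ) < aredRed μ f g (x ℓ) (d ℓ)) →
    x (ℓ + 1) = x ℓ + d ℓ
  /-- (iv) update on an unsuccessful iteration -/
  fail_update : ∀ ℓ, ¬((∀ i, 0 < g i (x ℓ + d ℓ)) ∧
      τ * predRed μ f g (x ℓ) (z ℓ) (d ℓ) < aredRed μ f g (x ℓ) (d ℓ)) →
    x (ℓ + 1) = x ℓ ∧ z (ℓ + 1) = z ℓ
  /-- (v) radius update: infeasible trial point -/
  Δ_infeas : ∀ ℓ, (∃ i, g i (x ℓ + d ℓ) ≤ 0) → Δ (ℓ + 1) = ω * ‖d ℓ‖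
  /-- (v) radius update: shrink -/
  Δ_shrink : ∀ ℓ, (∀ i, 0 < g i (x ℓ + d ℓ)) →
    aredRed μ f g (x ℓ) (d ℓ) < predRed μ f g (x ℓ) (z ℓ) (d ℓ) / 4 →
    Δ (ℓ + 1) = Δ ℓ / 4
  /-- (v) radius update: expand -/
  Δ_expand : ∀ ℓ, (∀ i, 0 < g i (x ℓ + d ℓ)) →
    (3/4) * predRed μ f g (x ℓ) (z ℓ) (d ℓ) ≤ aredRed μ f g (x ℓ) (d ℓ) →
    ‖d ℓ‖ = Δ ℓ → Δ (ℓ + 1) = min (2 * Δ ℓ) Δmax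
  /-- (v) radius update: remaining cases -/
  Δ_keep : ∀ ℓ, (∀ i, 0 < g i (x ℓ + d ℓ)) →
    ¬(aredRed μ f g (x ℓ) (d ℓ) < predRed μ f g (x ℓ) (z ℓ) (d ℓ) / 4) →
    ¬((3/4) * predRed μ f g (x ℓ) (z ℓ) (d ℓ) ≤ aredRed μ f g (x ℓ) (d ℓ) ∧ ‖d ℓ‖ = Δ ℓ) →
    Δ (ℓ + 1) = Δ ℓ
  /-- uniform bounds along the iterates -/
  bound_fbelow : ∃ Lb : ℝ, ∀ ℓ, Lb ≤ f (x ℓ)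
  bound_g : ∃ U > (0:ℝ), ∀ ℓ i, g i (x ℓ) ≤ U
  bound_gradg : ∃ Cg > (0:ℝ), ∀ ℓ i, ‖gradient (g i) (x ℓ)‖ ≤ Cg
  bound_hessg : ∃ CG > (0:ℝ), ∀ ℓ i, ‖Hess (g i) (x ℓ)‖ ≤ CG
  bound_hessf : ∃ Cf > (0:ℝ), ∀ ℓ, ‖Hess f (x ℓ)‖ ≤ Cf
  bound_z : ∃ Cz > (0:ℝ), ∀ ℓ i, z ℓ i ≤ Cz
  /-- uniform continuity of each `g i` along the iterates -/
  unif_cont : ∀ η > (0:ℝ), ∃ δ > (0:ℝ), ∀ ℓ i (v : E), ‖v‖ ≤ δ →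
    |g i (x ℓ + v) - g i (x ℓ)| ≤ η
  /-- radial Lipschitz bound for the gradients of the constraints -/
  radial_grad : ∃ β₁ > (0:ℝ), ∃ δ₁ > (0:ℝ), ∀ ℓ i (t : ℝ) (v : E), 0 ≤ t → t * ‖v‖ ≤ δ₁ →
    |⟪gradient (g i) (x ℓ + t • v) - gradient (g i) (x ℓ), v⟫| ≤ β₁ * t * ‖v‖ ^ 2
  /-- radial Lipschitz bound for the Hessians of `f` and of the constraints -/
  radial_hess : ∃ β₂ > (0:ℝ), ∃ δ₂ > (0:ℝ), ∀ ℓ (t : ℝ) (v : E), 0 ≤ t → t * ‖v‖ ≤ δ₂ →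
    |⟪(Hess f (x ℓ + t • v) - Hess f (x ℓ)) v, v⟫| ≤ β₂ * t * ‖v‖ ^ 3 ∧
    ∀ i, |⟪(Hess (g i) (x ℓ + t • v) - Hess (g i) (x ℓ)) v, v⟫| ≤ β₂ * t * ‖v‖ ^ 3

lemma abs_sub_le_of_abs_deriv_le {h h' : ℝ → ℝ} {C : ℝ}
    (hd : ∀ t ∈ Set.Icc (0 : ℝ) 1, HasDerivAt h (h' t) t)
    (hb : ∀ t ∈ Set.Icc (0 : ℝ) 1, |h' t| ≤ C) {t : ℝ} (ht : t ∈ Set.Icc (0 : ℝ) 1) :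
    |h t - h 0| ≤ C := by
  have hC : 0 ≤ C := (abs_nonneg _).trans (hb t ht)
  have key := norm_image_sub_le_of_norm_deriv_le_segment' (f := h) (f' := h') (C := C)
    (fun s hs => (hd s hs).hasDerivWithinAt)
    (fun s hs => hb s (Set.Ico_subset_Icc_self hs)) t ht
  rw [Real.norm_eq_abs] at key
  nlinarith [ht.2]

lemma abs_sub_sub_deriv_le {h h' : ℝ → ℝ} {C : ℝ}
    (hd : ∀ t ∈ Set.Icc (0 : ℝ) 1, HasDerivAt h (h' t) t)
    (hb : ∀ t ∈ Set.Icc (0 : ℝ) 1, |h' t - h' 0| ≤ C) :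
    |h 1 - h 0 - h' 0| ≤ C := by
  have key := abs_sub_le_of_abs_deriv_le (h := fun t => h t - h' 0 * t)
    (h' := fun t => h' t - h' 0)
    (fun t ht => (hd t ht).sub (by simpa using (hasDerivAt_id t).const_mul (h' 0))) hb
    (t := 1) (by simp)
  have e : h 1 - h 0 - h' 0 = (h 1 - h' 0 * 1) - (h 0 - h' 0 * 0) := by ring
  rw [e]
  exact key

lemma abs_log_sub_sub_le {a a' : ℝ → ℝ} {c A B : ℝ} (hc : 0 < c)
    (hd : ∀ t ∈ Set.Icc (0 : ℝ) 1, HasDerivAt a (a' t) t)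
    (ha : ∀ t ∈ Set.Icc (0 : ℝ) 1, c ≤ a t)
    (hA : ∀ t ∈ Set.Icc (0 : ℝ) 1, |a' t| ≤ A)
    (hB : ∀ t ∈ Set.Icc (0 : ℝ) 1, |a' t - a' 0| ≤ B) :
    |Real.log (a 1) - Real.log (a 0) - (a 0)⁻¹ * a' 0| ≤ B / c + A ^ 2 / c ^ 2 := by
  have h0 : (0 : ℝ) ∈ Set.Icc (0 : ℝ) 1 := by simp
  have a0 := hc.trans_le (ha 0 h0)
  have key := abs_sub_sub_deriv_le (h := fun t => Real.log (a t)) (h' := fun t => a' t / a t)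
    (C := B / c + A ^ 2 / c ^ 2)
    (fun t ht => (hd t ht).log (hc.trans_le (ha t ht)).ne') ?_
  · simpa only [div_eq_inv_mul] using key
  · intro t ht
    have at0 := hc.trans_le (ha t ht)
    have e : a' t / a t - a' 0 / a 0
        = (a' t - a' 0) / a t + a' 0 * (a 0 - a t) / (a 0 * a t) := by
      field_simp
      ring
    have hdiff : |a 0 - a t| ≤ A := by
      rw [abs_sub_comm]
      exact abs_sub_le_of_abs_deriv_le hd hA ht
    have hAn : 0 ≤ A := (abs_nonneg _).trans (hA 0 h0)
    have hBn : 0 ≤ B := (abs_nonneg _).trans (hB 0 h0)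
    rw [e]
    refine (abs_add_le _ _).trans (add_le_add ?_ ?_)
    · rw [abs_div, abs_of_pos at0]
      exact div_le_div₀ hBn (hB t ht) hc (ha t ht)
    · rw [abs_div, abs_mul, abs_of_pos (mul_pos a0 at0), sq, sq]
      exact div_le_div₀ (by positivity)
        (mul_le_mul (hA 0 h0) hdiff (abs_nonneg _) hAn) (by positivity)
        (mul_le_mul (ha 0 h0) (ha t ht) hc.le a0.le)

lemma hasDerivAt_comp_line {h : E → ℝ} (hh : ContDiff ℝ 2 h) (x v : E) (t : ℝ) :
    HasDerivAt (fun s : ℝ => h (x + s • v)) ⟪gradient h (x + t • v), v⟫ t := by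
  have h1 : HasFDerivAt h _ (x + t • v) :=
    ((hh.differentiable (by norm_num)) (x + t • v)).hasGradientAt.hasFDerivAt
  have h2 : HasDerivAt (fun s : ℝ => x + s • v) v t := by
    simpa using ((hasDerivAt_id t).smul_const v).const_add x
  exact h1.comp_hasDerivAt t h2

lemma hasDerivAt_inner_gradient_line {h : E → ℝ} (hh : ContDiff ℝ 2 h) (x v : E) (t : ℝ) :
    HasDerivAt (fun s : ℝ => ⟪gradient h (x + s • v), v⟫) ⟪Hess h (x + t • v) v, v⟫ t := by
  have hg : Differentiable ℝ (gradient h) := by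
    have h1 : ContDiff ℝ 1 (fderiv ℝ h) := hh.fderiv_right (by norm_num)
    exact (InnerProductSpace.toDual ℝ E).symm.differentiable.comp
      (h1.differentiable (by norm_num))
  have h2 : HasDerivAt (fun s : ℝ => x + s • v) v t := by
    simpa using ((hasDerivAt_id t).smul_const v).const_add x
  have h3 := (hg (x + t • v)).hasFDerivAt.comp_hasDerivAt t h2
  simpa [Hess] using h3.inner ℝ (hasDerivAt_const t v)

lemma false_of_descent_or_contraction {φ Δ : ℕ → ℝ} {N : ℕ} {s γ δ D B : ℝ}
    (hs : 0 < s) (hγ : γ < 1) (hδ : 0 < δ) (hB : ∀ n, B ≤ φ n)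
    (hΔ : ∀ n, N ≤ n → δ ≤ Δ n) (hD : ∀ n, Δ n ≤ D)
    (hstep : ∀ n, N ≤ n →
      φ (n + 1) ≤ φ n - s ∨ (φ (n + 1) ≤ φ n ∧ Δ (n + 1) ≤ γ * Δ n)) : False := by
  have hDpos : 0 < D := hδ.trans_le ((hΔ N le_rfl).trans (hD N))
  obtain ⟨l, hl, hlD⟩ : ∃ l, 0 < l ∧ l * D = s / 2 :=
    ⟨s / 2 / D, by positivity, by field_simp⟩
  obtain ⟨r, hr, hr1, hr2⟩ : ∃ r, 0 < r ∧ r ≤ s / 2 ∧ r ≤ l * ((1 - γ) * δ) :=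
    ⟨min (s / 2) (l * ((1 - γ) * δ)),
      lt_min (by positivity) (mul_pos hl (mul_pos (by linarith) hδ)),
      min_le_left _ _, min_le_right _ _⟩
  have hdec : ∀ k : ℕ, φ (N + k) + l * Δ (N + k) ≤ φ N + l * Δ N - k * r := by
    intro k
    induction k with
    | zero => simp
    | succ k ih =>
      have hδk := hΔ (N + k) (by omega)
      push_cast
      rw [← add_assoc]
      rcases hstep (N + k) (by omega) with h | ⟨h, h'⟩
      · have h1 := mul_le_mul_of_nonneg_left (hD (N + k + 1)) hl.le
        have h2 : 0 ≤ l * Δ (N + k) := mul_nonneg hl.le (hδ.le.trans hδk)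
        linarith
      · have h1 := mul_le_mul_of_nonneg_left h' hl.le
        have h2 := mul_le_mul_of_nonneg_left
          (mul_le_mul_of_nonneg_left hδk (by linarith : (0 : ℝ) ≤ 1 - γ)) hl.le
        linarith
  obtain ⟨k, hk⟩ := exists_nat_gt ((φ N + l * Δ N - B) / r)
  rw [div_lt_iff₀ hr] at hk
  have h1 := hdec k
  have h2 : 0 ≤ l * Δ (N + k) := mul_nonneg hl.le (hδ.le.trans (hΔ (N + k) (by omega)))
  linarith [hB (N + k)]

lemma norm_Hxz_le {m : ℕ} {f : E → ℝ} {g : Fin m → E → ℝ} {x : E} {z : Fin m → ℝ}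
    {c Cf CG Cg Cz : ℝ} (hc : 0 < c) (hf : ‖Hess f x‖ ≤ Cf) (hG : ∀ i, ‖Hess (g i) x‖ ≤ CG)
    (hg : ∀ i, ‖gradient (g i) x‖ ≤ Cg) (hz : ∀ i, 0 < z i) (hzC : ∀ i, z i ≤ Cz)
    (hcg : ∀ i, c ≤ g i x) :
    ‖Hxz f g x z‖ ≤ Cf + m * (Cz * CG) + m * (Cz / c * (Cg * Cg)) := by
  have h1 : ‖∑ i, z i • Hess (g i) x‖ ≤ m * (Cz * CG) := by
    have := norm_sum_le_of_le (Finset.univ) (f := fun i => z i • Hess (g i) x)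
      (n := fun _ => Cz * CG) (fun i _ => by
        rw [norm_smul, Real.norm_of_nonneg (hz i).le]
        exact mul_le_mul (hzC i) (hG i) (norm_nonneg _) ((hz i).le.trans (hzC i)))
    simpa using this
  have h2 : ‖∑ i, (z i / g i x) •
      ((innerSL ℝ (gradient (g i) x)).smulRight (gradient (g i) x))‖
      ≤ m * (Cz / c * (Cg * Cg)) := by
    have := norm_sum_le_of_le (Finset.univ) (f := fun i => (z i / g i x) •
      ((innerSL ℝ (gradient (g i) x)).smulRight (gradient (g i) x)))
      (n := fun _ => Cz / c * (Cg * Cg)) (fun i _ => by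
        have hCz : 0 ≤ Cz := (hz i).le.trans (hzC i)
        have hgx := hc.trans_le (hcg i)
        rw [norm_smul, Real.norm_of_nonneg (div_pos (hz i) hgx).le,
          ContinuousLinearMap.norm_smulRight_apply, innerSL_apply_norm]
        exact mul_le_mul (div_le_div₀ hCz (hzC i) hc (hcg i))
          (mul_self_le_mul_self (norm_nonneg _) (hg i)) (by positivity) (by positivity))
    simpa using this
  unfold Hxz hessL
  refine (norm_add_le _ _).trans (add_le_add ((norm_sub_le _ _).trans (add_le_add hf h1)) h2)

namespace InnerSetting

variable {m : ℕ} {f : E → ℝ} {g : Fin m → E → ℝ} {μ τ κC ω Δmax : ℝ}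
    {x : ℕ → E} {z : ℕ → Fin m → ℝ} {d : ℕ → E} {Δ : ℕ → ℝ}

lemma predRed_nonneg (S : InnerSetting m f g μ τ κC ω Δmax x z d Δ) (n : ℕ) :
    0 ≤ predRed μ f g (x n) (z n) (d n) := by
  have hΔ := (S.hΔ n).1.le
  have hκ := S.hκC.le
  by_cases h : Hxz f g (x n) (z n) = 0
  · exact le_trans (by positivity) (S.cauchy_zero n h)
  · exact le_trans (mul_nonneg (by positivity) (le_min hΔ (by positivity))) (S.cauchy n h)

lemma le_predRed (S : InnerSetting m f g μ τ κC ω Δmax x z d Δ) {n : ℕ} {ε CH : ℝ}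
    (hε : 0 < ε) (hq : ε ≤ ‖qmu μ f g (x n)‖) (hH : ‖Hxz f g (x n) (z n)‖ ≤ CH) :
    κC * ε * min (Δ n) (ε / CH) ≤ predRed μ f g (x n) (z n) (d n) := by
  have hΔ := (S.hΔ n).1.le
  have hκ := S.hκC.le
  have hCH : 0 ≤ CH := (norm_nonneg _).trans hH
  by_cases h : Hxz f g (x n) (z n) = 0
  · refine le_trans ?_ (S.cauchy_zero n h)
    exact mul_le_mul (mul_le_mul_of_nonneg_left hq hκ) (min_le_left _ _)
      (le_min hΔ (by positivity)) (by positivity)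
  · refine le_trans ?_ (S.cauchy n h)
    refine mul_le_mul (mul_le_mul_of_nonneg_left hq hκ) (min_le_min le_rfl ?_)
      (le_min hΔ (by positivity)) (by positivity)
    exact div_le_div₀ (norm_nonneg _) hq (norm_pos_iff.mpr h) hH

lemma barrierPhi_succ_le (S : InnerSetting m f g μ τ κC ω Δmax x z d Δ) (n : ℕ) :
    barrierPhi μ f g (x (n + 1)) ≤ barrierPhi μ f g (x n) := by
  by_cases h : (∀ i, 0 < g i (x n + d n)) ∧
      τ * predRed μ f g (x n) (z n) (d n) < aredRed μ f g (x n) (d n)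
  · rw [S.succ_update n h]
    have h1 := mul_nonneg S.hτ.1.le (S.predRed_nonneg n)
    have h2 := h.2
    unfold aredRed at h2
    linarith
  · rw [(S.fail_update n h).1]

lemma exists_le_barrierPhi (S : InnerSetting m f g μ τ κC ω Δmax x z d Δ) :
    ∃ B, ∀ n, B ≤ barrierPhi μ f g (x n) := by
  obtain ⟨Lb, hLb⟩ := S.bound_fbelow
  obtain ⟨U, -, hU⟩ := S.bound_g
  refine ⟨Lb - μ * (m * Real.log U), fun n => ?_⟩
  have h1 : ∑ i, Real.log (g i (x n)) ≤ m * Real.log U := by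
    have := Finset.sum_le_card_nsmul Finset.univ (fun i => Real.log (g i (x n))) (Real.log U)
      (fun i _ => Real.log_le_log (S.hgpos n i) (hU n i))
    simpa using this
  have h2 := mul_le_mul_of_nonneg_left h1 S.hμ.le
  unfold barrierPhi
  linarith [hLb n]

lemma exists_pos_le_constraint (S : InnerSetting m f g μ τ κC ω Δmax x z d Δ) :
    ∃ c > 0, ∀ n i, c ≤ g i (x n) := by
  obtain ⟨Lb, hLb⟩ := S.bound_fbelow
  obtain ⟨U, -, hU⟩ := S.bound_g
  have hanti : Antitone fun n => barrierPhi μ f g (x n) :=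
    antitone_nat_of_succ_le S.barrierPhi_succ_le
  have hV : 0 ≤ Real.log (max U 1) := Real.log_nonneg (le_max_right _ _)
  refine ⟨Real.exp ((Lb - barrierPhi μ f g (x 0)) / μ - m * Real.log (max U 1)),
    Real.exp_pos _, fun n j => ?_⟩
  rw [← Real.le_log_iff_exp_le (S.hgpos n j)]
  have h1 : ∑ i, Real.log (g i (x n)) ≤ Real.log (g j (x n)) + m * Real.log (max U 1) := by
    rw [← Finset.add_sum_erase _ _ (Finset.mem_univ j)]
    have h2 := Finset.sum_le_sum (s := Finset.univ.erase j)
      (f := fun i => Real.log (g i (x n))) (g := fun _ => Real.log (max U 1))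
      (fun i _ => Real.log_le_log (S.hgpos n i) ((hU n i).trans (le_max_left _ _)))
    have h3 := Finset.sum_le_sum_of_subset_of_nonneg (Finset.erase_subset j Finset.univ)
      (f := fun _ => Real.log (max U 1)) (fun _ _ _ => hV)
    have h4 : ∑ _i : Fin m, Real.log (max U 1) = m * Real.log (max U 1) := by simp
    linarith
  have h2 : (Lb - barrierPhi μ f g (x 0)) / μ ≤ ∑ i, Real.log (g i (x n)) := by
    rw [div_le_iff₀ S.hμ]
    have h3 : barrierPhi μ f g (x n) ≤ barrierPhi μ f g (x 0) := hanti (Nat.zero_le n)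
    have h4 := hLb n
    unfold barrierPhi at h3 ⊢
    linarith
  linarith

lemma exists_abs_barrierPhi_sub_le (S : InnerSetting m f g μ τ κC ω Δmax x z d Δ) :
    ∃ K ≥ 0, ∃ δ > 0, ∀ n (v : E), ‖v‖ ≤ δ → (∀ i, 0 < g i (x n + v)) ∧
      |barrierPhi μ f g (x n + v) - barrierPhi μ f g (x n) - ⟪qmu μ f g (x n), v⟫|
        ≤ K * ‖v‖ ^ 2 := by
  obtain ⟨c, hc, hcg⟩ := S.exists_pos_le_constraint
  obtain ⟨δ, hδ, hunif⟩ := S.unif_cont (c / 2) (by positivity)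
  obtain ⟨Cg, hCg, hgrad⟩ := S.bound_gradg
  obtain ⟨Cf, hCf, hHf⟩ := S.bound_hessf
  obtain ⟨β₁, hβ₁, δ₁, hδ₁, hrg⟩ := S.radial_grad
  obtain ⟨β₂, hβ₂, δ₂, hδ₂, hrh⟩ := S.radial_hess
  have hμ := S.hμ
  refine ⟨(Cf + β₂) + μ * (m * (β₁ / (c / 2) + (Cg + β₁) ^ 2 / (c / 2) ^ 2)), by positivity,
    min (min δ 1) (min δ₁ δ₂), by positivity, fun n v hv => ?_⟩
  simp only [le_min_iff] at hv
  obtain ⟨⟨hv0, hv1⟩, hv2, hv3⟩ := hv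
  have hle : ∀ t ∈ Set.Icc (0 : ℝ) 1, t * ‖v‖ ≤ ‖v‖ := fun t ht =>
    mul_le_of_le_one_left (norm_nonneg _) ht.2
  have hlow : ∀ i, ∀ t ∈ Set.Icc (0 : ℝ) 1, c / 2 ≤ g i (x n + t • v) := by
    intro i t ht
    have h1 := hunif n i (t • v) (by
      rw [norm_smul, Real.norm_of_nonneg ht.1]
      exact (hle t ht).trans hv0)
    linarith [(abs_le.mp h1).1, hcg n i]
  have hfpart : |f (x n + v) - f (x n) - ⟪gradient f (x n), v⟫| ≤ (Cf + β₂) * ‖v‖ ^ 2 := by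
    have hH : ∀ t ∈ Set.Icc (0 : ℝ) 1, |⟪Hess f (x n + t • v) v, v⟫| ≤ (Cf + β₂) * ‖v‖ ^ 2 := by
      intro t ht
      have h1 := (hrh n t v ht.1 ((hle t ht).trans hv3)).1
      have h2 : |⟪Hess f (x n) v, v⟫| ≤ Cf * ‖v‖ ^ 2 := by
        refine (abs_real_inner_le_norm _ _).trans ?_
        rw [sq, ← mul_assoc]
        gcongr
        exact (Hess f (x n)).le_of_opNorm_le (hHf n) v
      have h3 : β₂ * t * ‖v‖ ^ 3 ≤ β₂ * ‖v‖ ^ 2 := by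
        have : t * ‖v‖ ≤ 1 := (hle t ht).trans hv1
        calc β₂ * t * ‖v‖ ^ 3 = (β₂ * ‖v‖ ^ 2) * (t * ‖v‖) := by ring
          _ ≤ β₂ * ‖v‖ ^ 2 := mul_le_of_le_one_right (by positivity) this
      rw [sub_apply, inner_sub_left] at h1
      have h4 := abs_sub_abs_le_abs_sub ⟪Hess f (x n + t • v) v, v⟫ ⟪Hess f (x n) v, v⟫
      linarith
    have key := abs_sub_sub_deriv_le (fun t _ => hasDerivAt_comp_line S.hf (x n) v t)
      (fun t ht => abs_sub_le_of_abs_deriv_le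
        (fun s _ => hasDerivAt_inner_gradient_line S.hf (x n) v s) hH ht)
    simpa using key
  have hgpart : ∀ i, |Real.log (g i (x n + v)) - Real.log (g i (x n)) -
      (g i (x n))⁻¹ * ⟪gradient (g i) (x n), v⟫| ≤
      (β₁ / (c / 2) + (Cg + β₁) ^ 2 / (c / 2) ^ 2) * ‖v‖ ^ 2 := by
    intro i
    have hB : ∀ t ∈ Set.Icc (0 : ℝ) 1,
        |⟪gradient (g i) (x n + t • v), v⟫ - ⟪gradient (g i) (x n), v⟫| ≤ β₁ * ‖v‖ ^ 2 := by
      intro t ht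
      rw [← inner_sub_left]
      refine (hrg n i t v ht.1 ((hle t ht).trans hv2)).trans ?_
      gcongr
      exact mul_le_of_le_one_right hβ₁.le ht.2
    have hA : ∀ t ∈ Set.Icc (0 : ℝ) 1,
        |⟪gradient (g i) (x n + t • v), v⟫| ≤ (Cg + β₁) * ‖v‖ := by
      intro t ht
      have h1 := hB t ht
      have h2 : |⟪gradient (g i) (x n), v⟫| ≤ Cg * ‖v‖ :=
        (abs_real_inner_le_norm _ _).trans
          (mul_le_mul_of_nonneg_right (hgrad n i) (norm_nonneg _))
      have h3 : ‖v‖ ^ 2 ≤ ‖v‖ := by nlinarith [norm_nonneg v]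
      have h4 := abs_sub_abs_le_abs_sub ⟪gradient (g i) (x n + t • v), v⟫
        ⟪gradient (g i) (x n), v⟫
      nlinarith
    have key := abs_log_sub_sub_le (half_pos hc)
      (fun t _ => hasDerivAt_comp_line (S.hg i) (x n) v t) (hlow i) hA
      (fun t ht => by simpa using hB t ht)
    simp only [one_smul, zero_smul, add_zero] at key
    refine key.trans (le_of_eq ?_)
    ring
  refine ⟨fun i => by simpa using (half_pos hc).trans_le (hlow i 1 (by simp)), ?_⟩
  have hsum : |∑ i, (Real.log (g i (x n + v)) - Real.log (g i (x n)) -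
      (g i (x n))⁻¹ * ⟪gradient (g i) (x n), v⟫)| ≤
      m * ((β₁ / (c / 2) + (Cg + β₁) ^ 2 / (c / 2) ^ 2) * ‖v‖ ^ 2) := by
    refine (Finset.abs_sum_le_sum_abs _ _).trans ?_
    simpa using Finset.sum_le_card_nsmul Finset.univ _ _ (fun i _ => hgpart i)
  have e : barrierPhi μ f g (x n + v) - barrierPhi μ f g (x n) - ⟪qmu μ f g (x n), v⟫ =
      (f (x n + v) - f (x n) - ⟪gradient f (x n), v⟫) -
      μ * ∑ i, (Real.log (g i (x n + v)) - Real.log (g i (x n)) -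
        (g i (x n))⁻¹ * ⟪gradient (g i) (x n), v⟫) := by
    simp only [barrierPhi, qmu, inner_sub_left, real_inner_smul_left, sum_inner,
      Finset.sum_sub_distrib]
    ring
  rw [e]
  refine (abs_sub _ _).trans ?_
  rw [abs_mul, abs_of_pos hμ]
  have := mul_le_mul_of_nonneg_left hsum hμ.le
  linarith

lemma exists_norm_Hxz_le (S : InnerSetting m f g μ τ κC ω Δmax x z d Δ) :
    ∃ CH > 0, ∀ n, ‖Hxz f g (x n) (z n)‖ ≤ CH := by
  obtain ⟨c, hc, hcg⟩ := S.exists_pos_le_constraint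
  obtain ⟨Cg, hCg, hgrad⟩ := S.bound_gradg
  obtain ⟨CG, hCG, hHg⟩ := S.bound_hessg
  obtain ⟨Cf, hCf, hHf⟩ := S.bound_hessf
  obtain ⟨Cz, hCz, hz⟩ := S.bound_z
  exact ⟨Cf + m * (Cz * CG) + m * (Cz / c * (Cg * Cg)), by positivity, fun n =>
    norm_Hxz_le hc (hHf n) (hHg n) (hgrad n) (S.hzpos n) (hz n) (hcg n)⟩

/-- While the barrier gradient stays away from zero, the reduction ratio is at least `3/4` for
small trust-region radii. -/
lemma exists_radius_ared_ge (S : InnerSetting m f g μ τ κC ω Δmax x z d Δ) {ε : ℝ}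
    (hε : 0 < ε) :
    ∃ r > 0, ∀ n, ε ≤ ‖qmu μ f g (x n)‖ →
      (‖d n‖ ≤ r → ∀ i, 0 < g i (x n + d n)) ∧
      (Δ n ≤ r → (3 / 4) * predRed μ f g (x n) (z n) (d n) ≤ aredRed μ f g (x n) (d n)) := by
  obtain ⟨K, hK, δ, hδ, hT⟩ := S.exists_abs_barrierPhi_sub_le
  obtain ⟨CH, hCH, hH⟩ := S.exists_norm_Hxz_le
  have hκ := S.hκC
  refine ⟨min δ (min (ε / CH) (κC * ε / (4 * (K + CH)))), by positivity, fun n hq => ⟨?_, ?_⟩⟩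
  · intro hd
    exact (hT n (d n) (hd.trans (min_le_left _ _))).1
  · intro hr
    simp only [le_min_iff] at hr
    obtain ⟨hr1, hr2, hr3⟩ := hr
    have hd := S.hdΔ n
    have hT := (abs_le.mp (hT n (d n) (hd.trans hr1)).2).2
    have hpred := S.le_predRed hε hq (hH n)
    rw [min_eq_left hr2] at hpred
    rw [le_div_iff₀ (by positivity)] at hr3
    have hquad : |⟪Hxz f g (x n) (z n) (d n), d n⟫| ≤ CH * ‖d n‖ ^ 2 := by
      refine (abs_real_inner_le_norm _ _).trans ?_
      rw [sq, ← mul_assoc]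
      gcongr
      exact (Hxz f g (x n) (z n)).le_of_opNorm_le (hH n) _
    have hquad' := (abs_le.mp hquad).1
    have hd2 : ‖d n‖ ^ 2 ≤ Δ n ^ 2 := by gcongr
    have hd3 := mul_le_mul_of_nonneg_left hd2 (by positivity : 0 ≤ K + CH)
    have hr4 := mul_le_mul_of_nonneg_right hr3 (S.hΔ n).1.le
    have hCd : 0 ≤ CH * ‖d n‖ ^ 2 := by positivity
    have e : aredRed μ f g (x n) (d n) - predRed μ f g (x n) (z n) (d n) =
        -(barrierPhi μ f g (x n + d n) - barrierPhi μ f g (x n) - ⟪qmu μ f g (x n), d n⟫) +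
          (1 / 2) * ⟪Hxz f g (x n) (z n) (d n), d n⟫ := by
      unfold aredRed predRed trModel
      ring
    nlinarith

/-- While the barrier gradient stays away from zero, so do the trust-region radii. -/
lemma exists_pos_le_radius (S : InnerSetting m f g μ τ κC ω Δmax x z d Δ) {ε : ℝ}
    (hε : 0 < ε) {N : ℕ} (hq : ∀ n, N ≤ n → ε ≤ ‖qmu μ f g (x n)‖) :
    ∃ δ > 0, ∀ n, N ≤ n → δ ≤ Δ n := by
  obtain ⟨r, hr, hgood⟩ := S.exists_radius_ared_ge hε
  have hω := S.hω.1
  have hΔN := (S.hΔ N).1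
  refine ⟨min (Δ N) (min (ω * r) (r / 4)), by positivity, fun n hn => ?_⟩
  induction n, hn using Nat.le_induction with
  | base => exact min_le_left _ _
  | succ n hn ih =>
    obtain ⟨h1, h2⟩ := hgood n (hq n hn)
    have hΔn := S.hΔ n
    by_cases hfeas : ∀ i, 0 < g i (x n + d n)
    · by_cases hsh : aredRed μ f g (x n) (d n) < predRed μ f g (x n) (z n) (d n) / 4
      · rw [S.Δ_shrink n hfeas hsh]
        have hrΔ : r < Δ n := by
          by_contra! hle
          linarith [h2 hle, S.predRed_nonneg n]
        exact ((min_le_right _ _).trans (min_le_right _ _)).trans (by linarith)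
      · by_cases hex : (3/4) * predRed μ f g (x n) (z n) (d n) ≤ aredRed μ f g (x n) (d n) ∧
            ‖d n‖ = Δ n
        · rw [S.Δ_expand n hfeas hex.1 hex.2]
          exact ih.trans (le_min (by linarith) hΔn.2)
        · rw [S.Δ_keep n hfeas hsh hex]
          exact ih
    · have hrd : r < ‖d n‖ := by
        by_contra! hle
        exact hfeas (h1 hle)
      push Not at hfeas
      rw [S.Δ_infeas n hfeas]
      exact ((min_le_right _ _).trans (min_le_left _ _)).trans
        (mul_le_mul_of_nonneg_left hrd.le hω.le)

lemma frequently_norm_qmu_lt (S : InnerSetting m f g μ τ κC ω Δmax x z d Δ) {ε : ℝ}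
    (hε : 0 < ε) : ∃ᶠ n in atTop, ‖qmu μ f g (x n)‖ < ε := by
  intro hev
  obtain ⟨N, hN⟩ := eventually_atTop.mp hev
  simp only [not_lt] at hN
  obtain ⟨δ, hδ, hΔ⟩ := S.exists_pos_le_radius hε hN
  obtain ⟨CH, hCH, hH⟩ := S.exists_norm_Hxz_le
  obtain ⟨B, hB⟩ := S.exists_le_barrierPhi
  have hκ := S.hκC
  have hτ := S.hτ
  have hp : 0 < κC * ε * min δ (ε / CH) := by positivity
  have hpred : ∀ n, N ≤ n →
      κC * ε * min δ (ε / CH) ≤ predRed μ f g (x n) (z n) (d n) := fun n hn =>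
    (mul_le_mul_of_nonneg_left (min_le_min (hΔ n hn) le_rfl) (by positivity)).trans
      (S.le_predRed hε (hN n hn) (hH n))
  refine false_of_descent_or_contraction (φ := fun n => barrierPhi μ f g (x n)) (Δ := Δ)
    (s := τ * (κC * ε * min δ (ε / CH))) (γ := max ω (1 / 4)) (mul_pos hτ.1 hp)
    (max_lt S.hω.2 (by norm_num)) hδ hB hΔ (fun n => (S.hΔ n).2) (fun n hn => ?_)
  have hpn := hpred n hn
  by_cases h : (∀ i, 0 < g i (x n + d n)) ∧
      τ * predRed μ f g (x n) (z n) (d n) < aredRed μ f g (x n) (d n)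
  · left
    have h1 := h.2
    have h2 := mul_le_mul_of_nonneg_left hpn hτ.1.le
    rw [S.succ_update n h]
    unfold aredRed at h1
    linarith
  · refine Or.inr ⟨S.barrierPhi_succ_le n, ?_⟩
    by_cases hfeas : ∀ i, 0 < g i (x n + d n)
    · have h1 : aredRed μ f g (x n) (d n) < predRed μ f g (x n) (z n) (d n) / 4 := by
        by_contra! hle
        refine h ⟨hfeas, lt_of_lt_of_le ?_ hle⟩
        have := mul_lt_mul_of_pos_right hτ.2 (hp.trans_le hpn)
        linarith
      rw [S.Δ_shrink n hfeas h1]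
      have := mul_le_mul_of_nonneg_right (le_max_right ω (1 / 4)) (S.hΔ n).1.le
      linarith
    · push Not at hfeas
      rw [S.Δ_infeas n hfeas]
      exact mul_le_mul (le_max_left _ _) (S.hdΔ n) (norm_nonneg _)
        (S.hω.1.le.trans (le_max_left _ _))

end InnerSetting

/-- Under the inner-iteration setting,
`liminf_{ℓ→∞} ‖q_μ(x^ℓ)‖ = 0`. -/
theorem inner_liminf_qmu_eq_zero
    {E : Type*} [NormedAddCommGroup E] [InnerProductSpace ℝ E] [FiniteDimensional ℝ E]
    [Nontrivial E] {m : ℕ}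
    (f : E → ℝ) (g : Fin m → E → ℝ) (μ τ κC ω Δmax : ℝ)
    (x : ℕ → E) (z : ℕ → Fin m → ℝ) (d : ℕ → E) (Δ : ℕ → ℝ)
    (hset : InnerSetting m f g μ τ κC ω Δmax x z d Δ) :
    liminf (fun ℓ => ‖qmu μ f g (x ℓ)‖) atTop = 0 := by
  have hnn : ∀ᶠ ℓ in atTop, 0 ≤ ‖qmu μ f g (x ℓ)‖ := Eventually.of_forall fun _ => norm_nonneg _
  have hfreq : ∀ ε > 0, ∃ᶠ ℓ in atTop, ‖qmu μ f g (x ℓ)‖ ≤ ε := fun ε hε =>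
    (hset.frequently_norm_qmu_lt hε).mono fun _ h => h.le
  have hbdd : IsBoundedUnder (· ≥ ·) atTop fun ℓ => ‖qmu μ f g (x ℓ)‖ := ⟨0, by simp⟩
  refine le_antisymm (le_of_forall_pos_le_add fun ε hε => ?_) ?_
  · rw [zero_add]
    exact liminf_le_of_frequently_le (hfreq ε hε) hbdd
  · exact le_liminf_of_le (IsCoboundedUnder.of_frequently_le (hfreq 1 one_pos)) hnn

end
end
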